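/- arXiv:2602.08831 — 3 statements merged into one kernel-verified Lean document; each statement's English description precedes it below -/
import Mathlib

section
/- Let P and Q be nonnegative self-adjoint operators on a complex Hilbert space H such that D(Q) ⊆ D(P), ⟨Px, x⟩ ≤ ⟨Qx, x⟩ for all x ∈ D(Q), and ker P = ker Q. If the range of P is closed in H, then the range of Q is closed in H. -/
/-!
STATEMENT 1: Let P and Q be nonnegative self-adjoint operators on a complex Hilbert space H
such that D(Q) ⊆ D(P), ⟨Px, x⟩ ≤ ⟨Qx, x⟩ for all x ∈ D(Q), and ker P = ker Q.
If the range of P is closed in H, then the range of Q is closed in H.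
-/

open scoped ComplexOrder

noncomputable section

variable {H : Type*} [NormedAddCommGroup H] [InnerProductSpace ℂ H] [CompleteSpace H]

/-- The kernel of a partially defined operator, as a submodule of the ambient space. -/
def pKer {R E F : Type*} [Ring R] [AddCommGroup E] [Module R E] [AddCommGroup F] [Module R F]
    (P : E →ₗ.[R] F) : Submodule R E :=
  (LinearMap.ker P.toFun).map P.domain.subtype

/-- The range of a partially defined operator. -/
def pRan {R E F : Type*} [Ring R] [AddCommGroup E] [Module R E] [AddCommGroup F] [Module R F]
    (P : E →ₗ.[R] F) : Submodule R F :=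
  LinearMap.range P.toFun

/-- `P` is nonnegative: `⟨Px, x⟩ ≥ 0` for all `x` in the domain of `P`. -/
def IsNonnegOp (P : H →ₗ.[ℂ] H) : Prop :=
  ∀ x : P.domain, 0 ≤ @inner ℂ H _ (P x) (x : H)

/-- A self-adjoint operator is symmetric. -/
theorem isFormalAdjoint_self_of_isSelfAdjoint {P : H →ₗ.[ℂ] H} (hP : IsSelfAdjoint P) :
    P.IsFormalAdjoint P := by
  have h := LinearPMap.adjoint_isFormalAdjoint hP.dense_domain
  rwa [LinearPMap.isSelfAdjoint_def.1 hP] at h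

open scoped InnerProductSpace in
/-- The orthogonal complement of the range of a self-adjoint operator lies in its kernel. -/
theorem orthogonal_pRan_le_pKer {P : H →ₗ.[ℂ] H} (hP : IsSelfAdjoint P) :
    (pRan P)ᗮ ≤ pKer P := by
  intro y hy
  have hy0 : ∀ x : P.domain, ⟪(0 : H), x⟫_ℂ = ⟪y, P x⟫_ℂ := fun x => by
    have hx : P x ∈ pRan P := ⟨x, rfl⟩
    rw [inner_zero_left, Submodule.inner_left_of_mem_orthogonal hx hy]
  have hmem := P.mem_adjoint_domain_of_exists y ⟨0, hy0⟩
  have happ := LinearPMap.adjoint_apply_eq hP.dense_domain ⟨y, hmem⟩ hy0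
  have hgraph : (y, (0 : H)) ∈ P.adjoint.graph :=
    LinearPMap.mem_graph_iff _ |>.2 ⟨⟨y, hmem⟩, rfl, happ⟩
  rw [LinearPMap.isSelfAdjoint_def.1 hP] at hgraph
  obtain ⟨x, hx, hPx⟩ := (LinearPMap.mem_graph_iff _).1 hgraph
  exact ⟨x, hPx, hx⟩

/-- A closed operator with closed range admits preimages of controlled norm. -/
theorem exists_preimage_norm_le_of_isClosed_pRan {P : H →ₗ.[ℂ] H} (hP : P.IsClosed)
    (hran : IsClosed (pRan P : Set H)) :
    ∃ C > 0, ∀ y ∈ pRan P, ∃ x : P.domain, P x = y ∧ ‖(x : H)‖ ≤ C * ‖y‖ := by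
  have : CompleteSpace P.graph := IsClosed.completeSpace_coe (hs := hP)
  have : CompleteSpace (pRan P) := hran.completeSpace_coe
  let f : P.graph →L[ℂ] pRan P :=
    ((ContinuousLinearMap.snd ℂ H H).comp P.graph.subtypeL).codRestrict (pRan P) fun p => by
      obtain ⟨x, -, hx⟩ := (LinearPMap.mem_graph_iff _).1 p.2
      exact ⟨x, hx⟩
  have hf : Function.Surjective f := by
    rintro ⟨_, x, rfl⟩
    exact ⟨⟨(x, P x), P.mem_graph x⟩, rfl⟩
  obtain ⟨C, hC, hpre⟩ := f.exists_preimage_norm_le hf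
  refine ⟨C, hC, fun y hy => ?_⟩
  obtain ⟨p, hp, hnorm⟩ := hpre ⟨y, hy⟩
  obtain ⟨x, hx₁, hx₂⟩ := (LinearPMap.mem_graph_iff _).1 p.2
  exact ⟨x, hx₂.trans (congrArg Subtype.val hp),
    hx₁ ▸ (norm_fst_le (p : H × H)).trans hnorm⟩

open scoped InnerProductSpace in
/-- A nonnegative self-adjoint operator with closed range has a spectral gap: its quadratic form
is coercive on the orthogonal complement of its kernel. -/
theorem exists_norm_sq_le_inner_of_isClosed_pRan {P : H →ₗ.[ℂ] H} (hP : IsSelfAdjoint P)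
    (hnn : IsNonnegOp P) (hran : IsClosed (pRan P : Set H)) :
    ∃ C > 0, ∀ x : P.domain, (x : H) ∈ (pKer P)ᗮ → ‖(x : H)‖ ^ 2 ≤ C * (⟪P x, x⟫_ℂ).re := by
  obtain ⟨C, hC, hpre⟩ := exists_preimage_norm_le_of_isClosed_pRan hP.isClosed hran
  refine ⟨C, hC, fun x hx => ?_⟩
  have : CompleteSpace (pRan P) := hran.completeSpace_coe
  have hxran : (x : H) ∈ pRan P := by
    rw [← Submodule.orthogonal_orthogonal (pRan P)]
    exact Submodule.orthogonal_le (orthogonal_pRan_le_pKer hP) hx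
  obtain ⟨z, hz, hzn⟩ := hpre x hxran
  have hPxz : ⟪P x, z⟫_ℂ = ⟪(x : H), x⟫_ℂ := by rw [isFormalAdjoint_self_of_isSelfAdjoint hP x z, hz]
  have hzz : (⟪(x : H), z⟫_ℂ).re ≤ C * ‖(x : H)‖ ^ 2 :=
    (re_inner_le_norm (𝕜 := ℂ) (x : H) z).trans (by nlinarith [norm_nonneg (x : H)])
  have hquad := (Complex.le_def.1 (hnn ((C : ℂ) • x - z))).1
  have hxx : (⟪(x : H), x⟫_ℂ).re = ‖(x : H)‖ ^ 2 := inner_self_eq_norm_sq (𝕜 := ℂ) (x : H)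
  simp only [LinearPMap.map_sub, LinearPMap.map_smul, Submodule.coe_sub, Submodule.coe_smul,
    inner_sub_left, inner_sub_right, inner_smul_left, inner_smul_right, hPxz, hz,
    Complex.conj_ofReal, Complex.sub_re, Complex.re_ofReal_mul, hxx, Complex.zero_re] at hquad
  refine le_of_mul_le_mul_left ?_ hC
  linarith

/-- A closed operator that is bounded below on the orthogonal complement of its kernel has closed
range. -/
theorem isClosed_pRan_of_norm_le {Q : H →ₗ.[ℂ] H} (hQ : Q.IsClosed)
    (hker : IsClosed (pKer Q : Set H)) {C : ℝ}
    (hbound : ∀ x : Q.domain, (x : H) ∈ (pKer Q)ᗮ → ‖(x : H)‖ ≤ C * ‖Q x‖) :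
    IsClosed (pRan Q : Set H) := by
  let S : Submodule ℂ (H × H) := Q.graph ⊓ (pKer Q)ᗮ.comap (LinearMap.fst ℂ H H)
  have hS : IsClosed (S : Set (H × H)) :=
    IsClosed.inter hQ ((pKer Q).isClosed_orthogonal.preimage continuous_fst)
  have : CompleteSpace S := hS.completeSpace_coe
  have : CompleteSpace (pKer Q) := hker.completeSpace_coe
  let f : S →L[ℂ] H := (ContinuousLinearMap.snd ℂ H H).comp S.subtypeL
  have hf : AntilipschitzWith (max C 1).toNNReal f := by
    refine AddMonoidHomClass.antilipschitz_of_bound f fun p => ?_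
    obtain ⟨x, hx₁, hx₂⟩ := (LinearPMap.mem_graph_iff _).1 p.2.1
    have hp : ‖(p : H × H).1‖ ≤ C * ‖(p : H × H).2‖ := by
      rw [← hx₁, ← hx₂]
      exact hbound x (hx₁ ▸ p.2.2)
    rw [Real.coe_toNNReal _ (zero_le_one.trans (le_max_right C 1))]
    refine max_le (hp.trans ?_) ?_
    · exact mul_le_mul_of_nonneg_right (le_max_left C 1) (norm_nonneg _)
    · exact le_mul_of_one_le_left (norm_nonneg _) (le_max_right C 1)
  have hran : (pRan Q : Set H) = Set.range f := by
    ext y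
    constructor
    · rintro ⟨x, rfl⟩
      obtain ⟨k, hk, hkx⟩ := (pKer Q).starProjection_apply_mem (x : H)
      refine ⟨⟨((x - k : Q.domain), Q (x - k)), Q.mem_graph _, ?_⟩, ?_⟩
      · change (x : H) - (k : H) ∈ (pKer Q)ᗮ
        have hk' : (k : H) = (pKer Q).starProjection x := hkx
        rw [hk']
        exact (pKer Q).sub_starProjection_mem_orthogonal _
      · change Q (x - k) = Q x
        have hk' : Q k = 0 := hk
        rw [LinearPMap.map_sub, hk', sub_zero]
    · rintro ⟨p, rfl⟩
      obtain ⟨x, -, hx⟩ := (LinearPMap.mem_graph_iff _).1 p.2.1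
      exact ⟨x, hx⟩
  rw [hran]
  exact hf.isClosed_range f.uniformContinuous

/-- The range of a self-adjoint operator is orthogonal to its kernel. -/
theorem pRan_le_orthogonal_pKer {P : H →ₗ.[ℂ] H} (hP : IsSelfAdjoint P) :
    pRan P ≤ (pKer P)ᗮ := by
  rintro _ ⟨x, rfl⟩ _ ⟨k, hk, rfl⟩
  have hk' : P k = 0 := hk
  have h := isFormalAdjoint_self_of_isSelfAdjoint hP k x
  rw [hk', inner_zero_left] at h
  exact h.symm

/-- The kernel of a self-adjoint operator is closed. -/
theorem isClosed_pKer {P : H →ₗ.[ℂ] H} (hP : IsSelfAdjoint P) : IsClosed (pKer P : Set H) := by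
  have h : pKer P = (pRan P)ᗮ :=
    le_antisymm
      ((Submodule.le_orthogonal_orthogonal _).trans
        (Submodule.orthogonal_le (pRan_le_orthogonal_pKer hP)))
      (orthogonal_pRan_le_pKer hP)
  rw [h]
  exact Submodule.isClosed_orthogonal _

theorem closed_range_of_dominating (P Q : H →ₗ.[ℂ] H)
    (hPsa : IsSelfAdjoint P) (hPnn : IsNonnegOp P)
    (hQsa : IsSelfAdjoint Q) (hQnn : IsNonnegOp Q)
    (hdom : Q.domain ≤ P.domain)
    (hle : ∀ (x : H) (hx : x ∈ Q.domain),
      @inner ℂ H _ (P ⟨x, hdom hx⟩) x ≤ @inner ℂ H _ (Q ⟨x, hx⟩) x)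
    (hker : pKer P = pKer Q)
    (hPcl : IsClosed ((pRan P : Submodule ℂ H) : Set H)) :
    IsClosed ((pRan Q : Submodule ℂ H) : Set H) := by
  obtain ⟨C, hC, hgap⟩ := exists_norm_sq_le_inner_of_isClosed_pRan hPsa hPnn hPcl
  refine isClosed_pRan_of_norm_le hQsa.isClosed (isClosed_pKer hQsa) (C := C) fun x hx => ?_
  have h₁ := hgap ⟨x, hdom x.2⟩ (hker ▸ hx)
  have h₂ := (Complex.le_def.1 (hle x x.2)).1
  have h₃ := re_inner_le_norm (𝕜 := ℂ) (Q x) (x : H)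
  have h₄ : ‖(x : H)‖ ^ 2 ≤ C * (‖Q x‖ * ‖(x : H)‖) :=
    h₁.trans (mul_le_mul_of_nonneg_left (h₂.trans h₃) hC.le)
  rcases (norm_nonneg (x : H)).eq_or_lt with h₀ | h₀
  · rw [← h₀]
    positivity
  · refine le_of_mul_le_mul_right ?_ h₀
    linarith
end
end

section
/- Let S from H₀ to H₁ and T from H₁ to H₂ be closed densely defined operators between complex Hilbert spaces with range S ⊆ ker T (a Hilbert complex). Then H₁ decomposes as the orthogonal direct sum H₁ = (ker T ∩ ker S†) ⊕ closure(range S) ⊕ closure(range T†), where the three summands are pairwise orthogonal. -/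
/-!
STATEMENT 6: Let S : H₀ → H₁ and T : H₁ → H₂ be closed densely defined operators between
complex Hilbert spaces with range S ⊆ ker T (a Hilbert complex). Then H₁ decomposes as the
orthogonal direct sum H₁ = (ker T ∩ ker S†) ⊕ closure(range S) ⊕ closure(range T†), where
the three summands are pairwise orthogonal.
-/

noncomputable section

section

variable {E F : Type*}
  [NormedAddCommGroup E] [InnerProductSpace ℂ E] [NormedAddCommGroup F] [InnerProductSpace ℂ F]

theorem mem_pKer_iff_mem_graph (P : E →ₗ.[ℂ] F) (x : E) : x ∈ pKer P ↔ (x, (0 : F)) ∈ P.graph := by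
  rw [LinearPMap.mem_graph_iff]
  constructor
  · rintro ⟨a, ha, rfl⟩
    exact ⟨a, rfl, ha⟩
  · rintro ⟨a, ha, h⟩
    exact ⟨a, h, ha⟩

theorem mem_pRan_iff_exists_mem_graph (P : E →ₗ.[ℂ] F) (y : F) :
    y ∈ pRan P ↔ ∃ x, (x, y) ∈ P.graph := by
  constructor
  · rintro ⟨a, rfl⟩
    exact ⟨a, P.mem_graph a⟩
  · rintro ⟨x, hx⟩
    obtain ⟨a, -, ha⟩ := P.mem_graph_iff.1 hx
    exact ⟨a, ha⟩

variable [CompleteSpace E]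

theorem orthogonal_pRan {P : E →ₗ.[ℂ] F} (hP : Dense (P.domain : Set E)) :
    (pRan P)ᗮ = pKer P.adjoint := by
  ext y
  rw [mem_pKer_iff_mem_graph, LinearPMap.adjoint_graph_eq_graph_adjoint hP,
    Submodule.mem_adjoint_iff, Submodule.mem_orthogonal]
  simp only [inner_zero_right, sub_zero, mem_pRan_iff_exists_mem_graph]
  exact ⟨fun h a b hab => h b ⟨a, hab⟩, fun h b ⟨a, hab⟩ => h a b hab⟩

theorem orthogonal_pRan_adjoint [CompleteSpace F] {P : E →ₗ.[ℂ] F}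
    (hP : Dense (P.domain : Set E)) (hc : P.IsClosed) :
    (pRan P.adjoint)ᗮ = pKer P := by
  have hgraph : ∀ y z, (y, z) ∈ P.adjoint.graph ↔
      ∀ a b, (a, b) ∈ P.graph → inner ℂ b y - inner ℂ a z = 0 := fun y z => by
    rw [LinearPMap.adjoint_graph_eq_graph_adjoint hP, Submodule.mem_adjoint_iff]
  ext x
  rw [mem_pKer_iff_mem_graph, Submodule.mem_orthogonal]
  constructor
  · intro hx
    let G : Submodule ℂ (WithLp 2 (E × F)) :=
      P.graph.comap (WithLp.linearEquiv 2 ℂ (E × F)).toLinearMap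
    have hG : _root_.IsClosed (G : Set (WithLp 2 (E × F))) :=
      IsClosed.preimage (WithLp.prod_continuous_ofLp 2 E F) hc
    suffices h : WithLp.toLp 2 (x, (0 : F)) ∈ Gᗮᗮ by
      rw [Submodule.orthogonal_orthogonal_eq_closure, hG.submodule_topologicalClosure_eq] at h
      exact h
    rw [Submodule.mem_orthogonal]
    intro w hw
    have hmem : (w.snd, -w.fst) ∈ P.adjoint.graph := by
      refine (hgraph _ _).2 fun a b hab => ?_
      have h := (Submodule.mem_orthogonal _ _).1 hw (WithLp.toLp 2 (a, b)) hab
      rw [WithLp.prod_inner_apply] at h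
      simpa [add_comm] using h
    have h := hx _ ((mem_pRan_iff_exists_mem_graph _ _).2 ⟨_, hmem⟩)
    rw [WithLp.prod_inner_apply]
    simpa using h
  · intro hx z hz
    obtain ⟨y, hy⟩ := (mem_pRan_iff_exists_mem_graph _ _).1 hz
    have h := (hgraph y z).1 hy x 0 hx
    rw [inner_zero_left, zero_sub, neg_eq_zero] at h
    exact inner_eq_zero_symm.1 h

end

theorem hilbert_complex_hodge_decomposition
    {H₀ H₁ H₂ : Type*}
    [NormedAddCommGroup H₀] [InnerProductSpace ℂ H₀] [CompleteSpace H₀]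
    [NormedAddCommGroup H₁] [InnerProductSpace ℂ H₁] [CompleteSpace H₁]
    [NormedAddCommGroup H₂] [InnerProductSpace ℂ H₂] [CompleteSpace H₂]
    (S : H₀ →ₗ.[ℂ] H₁) (T : H₁ →ₗ.[ℂ] H₂)
    (hSd : Dense (S.domain : Set H₀)) (hSc : S.IsClosed)
    (hTd : Dense (T.domain : Set H₁)) (hTc : T.IsClosed)
    (hST : pRan S ≤ pKer T) :
    (∀ x ∈ pKer T ⊓ pKer S.adjoint, ∀ y ∈ (pRan S).topologicalClosure,
      @inner ℂ H₁ _ x y = 0) ∧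
    (∀ x ∈ pKer T ⊓ pKer S.adjoint, ∀ y ∈ (pRan T.adjoint).topologicalClosure,
      @inner ℂ H₁ _ x y = 0) ∧
    (∀ x ∈ (pRan S).topologicalClosure, ∀ y ∈ (pRan T.adjoint).topologicalClosure,
      @inner ℂ H₁ _ x y = 0) ∧
    (pKer T ⊓ pKer S.adjoint) ⊔ (pRan S).topologicalClosure ⊔
      (pRan T.adjoint).topologicalClosure = ⊤ := by
  have hS := orthogonal_pRan hSd
  have hT := orthogonal_pRan_adjoint hTd hTc
  rw [← hS, ← hT, ← Submodule.orthogonal_closure (pRan S),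
    ← Submodule.orthogonal_closure (pRan T.adjoint)]
  rw [← hT, ← Submodule.orthogonal_closure (pRan T.adjoint)] at hST
  have hle : (pRan S).topologicalClosure ≤ (pRan T.adjoint).topologicalClosureᗮ :=
    Submodule.topologicalClosure_minimal _ hST (Submodule.isClosed_orthogonal _)
  have : CompleteSpace (pRan S).topologicalClosure :=
    (pRan S).isClosed_topologicalClosure.completeSpace_coe
  have : CompleteSpace (pRan T.adjoint).topologicalClosure :=
    (pRan T.adjoint).isClosed_topologicalClosure.completeSpace_coe
  refine ⟨fun x hx y hy => Submodule.inner_left_of_mem_orthogonal hy hx.2,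
    fun x hx y hy => Submodule.inner_left_of_mem_orthogonal hy hx.1,
    fun x hx y hy => Submodule.inner_left_of_mem_orthogonal hy (hle hx), ?_⟩
  rw [sup_comm (_ ⊓ _), inf_comm, Submodule.sup_orthogonal_inf_of_hasOrthogonalProjection hle,
    sup_comm, Submodule.sup_orthogonal_of_hasOrthogonalProjection]
end
end

section
/- Let S from H₀ to H₁ and T from H₁ to H₂ be closed densely defined operators between complex Hilbert spaces with range S ⊆ ker T (a Hilbert complex). Then ker T decomposes as the orthogonal direct sum ker T = (ker T ∩ ker S†) ⊕ closure(range S). -/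
/-!
STATEMENT 7: Let S : H₀ → H₁ and T : H₁ → H₂ be closed densely defined operators between
complex Hilbert spaces with range S ⊆ ker T (a Hilbert complex). Then ker T decomposes as
the orthogonal direct sum ker T = (ker T ∩ ker S†) ⊕ closure(range S).
-/

noncomputable section

theorem mem_pKer_iff {R E F : Type*} [Ring R] [AddCommGroup E] [Module R E] [AddCommGroup F]
    [Module R F] (P : E →ₗ.[R] F) (x : E) : x ∈ pKer P ↔ (x, (0 : F)) ∈ P.graph := by
  simp [pKer, LinearPMap.mem_graph_iff]

/-- The kernel of a closed operator is closed. -/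
theorem isClosed_pKer_s7 {R E F : Type*} [CommRing R] [AddCommGroup E] [Module R E]
    [AddCommGroup F] [Module R F] [TopologicalSpace E] [TopologicalSpace F]
    {P : E →ₗ.[R] F} (hP : P.IsClosed) : IsClosed (pKer P : Set E) := by
  have h : (pKer P : Set E) = (fun x : E => (x, (0 : F))) ⁻¹' (P.graph : Set (E × F)) := by
    ext x
    exact mem_pKer_iff P x
  rw [h]
  exact IsClosed.preimage (by fun_prop) hP

/-- The kernel of the adjoint is the orthogonal complement of the range. -/
theorem pKer_adjoint {𝕜 E F : Type*} [RCLike 𝕜] [NormedAddCommGroup E] [InnerProductSpace 𝕜 E]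
    [CompleteSpace E] [NormedAddCommGroup F] [InnerProductSpace 𝕜 F]
    (P : E →ₗ.[𝕜] F) (hP : Dense (P.domain : Set E)) : pKer P.adjoint = (pRan P)ᗮ := by
  ext y
  rw [Submodule.mem_orthogonal']
  constructor
  · rintro ⟨z, hz, rfl⟩ _ ⟨x, rfl⟩
    have h := LinearPMap.adjoint_isFormalAdjoint hP z x
    have hz' : P.adjoint z = 0 := hz
    rw [hz', inner_zero_left] at h
    exact h.symm
  · intro hy
    have h : ∀ x : P.domain, inner 𝕜 (0 : E) x = inner 𝕜 y (P x) := fun x => by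
      rw [inner_zero_left]
      exact (hy _ ⟨x, rfl⟩).symm
    exact ⟨⟨y, LinearPMap.mem_adjoint_domain_of_exists y ⟨0, h⟩⟩,
      LinearPMap.adjoint_apply_eq hP _ h, rfl⟩

theorem hilbert_complex_kernel_decomposition
    {H₀ H₁ H₂ : Type*}
    [NormedAddCommGroup H₀] [InnerProductSpace ℂ H₀] [CompleteSpace H₀]
    [NormedAddCommGroup H₁] [InnerProductSpace ℂ H₁] [CompleteSpace H₁]
    [NormedAddCommGroup H₂] [InnerProductSpace ℂ H₂] [CompleteSpace H₂]
    (S : H₀ →ₗ.[ℂ] H₁) (T : H₁ →ₗ.[ℂ] H₂)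
    (hSd : Dense (S.domain : Set H₀)) (hSc : S.IsClosed)
    (hTd : Dense (T.domain : Set H₁)) (hTc : T.IsClosed)
    (hST : pRan S ≤ pKer T) :
    (∀ x ∈ pKer T ⊓ pKer S.adjoint, ∀ y ∈ (pRan S).topologicalClosure,
      @inner ℂ H₁ _ x y = 0) ∧
    (pKer T ⊓ pKer S.adjoint) ⊔ (pRan S).topologicalClosure = pKer T := by
  rw [pKer_adjoint S hSd, ← Submodule.orthogonal_closure]
  refine ⟨fun x hx y hy => Submodule.inner_left_of_mem_orthogonal hy hx.2, ?_⟩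
  have : CompleteSpace (pRan S).topologicalClosure :=
    (pRan S).isClosed_topologicalClosure.completeSpace_coe
  rw [sup_comm, inf_comm]
  exact Submodule.sup_orthogonal_inf_of_hasOrthogonalProjection
    ((pRan S).topologicalClosure_minimal hST (isClosed_pKer_s7 hTc))
end
end
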